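/- (Theorem 2.1, conclusion) If μ^(0) is a valid starting value for Algorithm 1 with μ_j^(0) ≤ L_j for all j, then the iterates μ^(k) converge componentwise to the vector L = (L_1,…,L_m) of lower confidence bounds, i.e., μ^∞ = L. -/

import Mathlib

open Filter Topology

/-- The adjusted p-value `p(μ) = min { p j (μ j) / w j μ : w j μ > 0 }`, where
`w j μ = q ^ max (μ j) 0 * ν j μ`. -/
noncomputable def padj (q : ℝ) {m : ℕ} (p : Fin m → ℝ → ℝ)
    (ν : Fin m → (Fin m → ℝ) → ℝ) (μ : Fin m → ℝ) : ℝ :=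
  sInf {x : ℝ | ∃ j : Fin m,
    0 < q ^ max (μ j) 0 * ν j μ ∧ x = p j (μ j) / (q ^ max (μ j) 0 * ν j μ)}

/-- If all weights are positive, the adjusted p-value exceeds `α` iff every p-value exceeds its
share `α * w j` of the level. -/
lemma lt_padj_iff {q α : ℝ} {m : ℕ} (hm : 1 ≤ m) {p : Fin m → ℝ → ℝ}
    {ν : Fin m → (Fin m → ℝ) → ℝ} {x : Fin m → ℝ}
    (hw : ∀ j, 0 < q ^ max (x j) 0 * ν j x) :
    α < padj q p ν x ↔ ∀ j, α * (q ^ max (x j) 0 * ν j x) < p j (x j) := by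
  have hset : {y : ℝ | ∃ j : Fin m, 0 < q ^ max (x j) 0 * ν j x ∧
      y = p j (x j) / (q ^ max (x j) 0 * ν j x)} =
      Set.range fun j => p j (x j) / (q ^ max (x j) 0 * ν j x) := by
    ext y
    simp [hw, eq_comm]
  have hne : Nonempty (Fin m) := ⟨⟨0, hm⟩⟩
  have hfin := Set.finite_range fun j => p j (x j) / (q ^ max (x j) 0 * ν j x)
  rw [padj, hset]
  constructor
  · intro h j
    rw [← lt_div_iff₀ (hw j)]
    exact h.trans_le (csInf_le hfin.bddBelow ⟨j, rfl⟩)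
  · intro h
    obtain ⟨j, hj⟩ := (Set.range_nonempty _).csInf_mem hfin
    rw [← hj, lt_div_iff₀ (hw j)]
    exact h j

/-- Let `w` be continuous with constant sum, each `w j` being non-decreasing in the coordinates
other than `j`. Arbitrarily close above a solution of `p j (a j) = w j a` there is a point with
`w j x < p j (x j)` for all `j`. -/
lemma exists_lt_of_eq {ι : Type*} [Fintype ι] [DecidableEq ι] {p : ι → ℝ → ℝ}
    (hp_cont : ∀ j, Continuous (p j)) (hp_mono : ∀ j, StrictMono (p j))
    {w : ι → (ι → ℝ) → ℝ} {c : ℝ} (hw_cont : ∀ j, Continuous (w j))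
    (hw_sum : ∀ x, ∑ j, w j x = c)
    (hw_mono : ∀ i j, i ≠ j → ∀ x t, x j ≤ t → w i x ≤ w i (Function.update x j t))
    {a : ι → ℝ} (ha : ∀ j, p j (a j) = w j a) {ε : ℝ} (hε : 0 < ε) :
    ∃ x : ι → ℝ, (∀ j, x j ≤ a j + ε) ∧ ∀ j, w j x < p j (x j) := by
  obtain ⟨δ, hδ, hδε⟩ : ∃ δ > 0, ∀ j, p j (a j) + Fintype.card ι * δ < p j (a j + ε) := by
    have h : ∀ j, ∀ᶠ δ : ℝ in 𝓝[>] 0, p j (a j) + Fintype.card ι * δ < p j (a j + ε) := by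
      intro j
      have hc : Continuous fun δ : ℝ => p j (a j) + Fintype.card ι * δ := by fun_prop
      refine nhdsWithin_le_nhds (hc.continuousAt.eventually_lt continuousAt_const ?_)
      simpa using hp_mono j (lt_add_of_pos_right _ hε)
    obtain ⟨δ, h1, h2⟩ := ((eventually_all.2 h).and self_mem_nhdsWithin).exists
    exact ⟨δ, h2, h1⟩
  set S : Set (ι → ℝ) := {x | a ≤ x ∧ ∀ j, p j (x j) ≤ w j x + δ} with hS
  have hbound : ∀ x ∈ S, ∀ j, x j ≤ a j + ε := by
    rintro x ⟨hax, hx⟩ j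
    rw [← (hp_mono j).le_iff_le]
    refine le_trans ?_ (hδε j).le
    have h1 : ∑ i, (p i (x i) - p i (a i)) ≤ Fintype.card ι * δ := by
      have h2 : ∑ i, p i (x i) ≤ ∑ i, (w i x + δ) := Finset.sum_le_sum fun i _ => hx i
      have h3 : ∑ i, p i (a i) = c := by simp only [ha, hw_sum]
      rw [Finset.sum_add_distrib, hw_sum] at h2
      rw [Finset.sum_sub_distrib, h3]
      simp only [Finset.sum_const, Finset.card_univ, nsmul_eq_mul] at h2
      linarith
    have h4 := Finset.single_le_sum (f := fun i => p i (x i) - p i (a i))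
      (fun i _ => sub_nonneg.2 ((hp_mono i).monotone (hax i))) (Finset.mem_univ j)
    linarith
  have hclosed : IsClosed S := by
    simp only [hS, Set.ofPred_and, Set.ofPred_forall]
    exact isClosed_Ici.inter <| isClosed_iInter fun j =>
      isClosed_le ((hp_cont j).comp (continuous_apply j)) ((hw_cont j).add continuous_const)
  have hcompact : IsCompact S :=
    (isCompact_Icc (a := a) (b := fun j => a j + ε)).of_isClosed_subset hclosed
      fun x hx => ⟨hx.1, hbound x hx⟩
  obtain ⟨x, hxS, hmax⟩ := hcompact.exists_isMaxOn
    ⟨a, le_rfl, fun j => by rw [ha]; linarith⟩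
    (f := fun x => ∑ j, x j) (by fun_prop)
  refine ⟨x, hbound x hxS, fun j => ?_⟩
  by_contra! hj
  have hupd : Continuous fun t => Function.update x j t := continuous_const.update j continuous_id
  have hev : ∀ᶠ t in 𝓝[>] x j, p j t < w j (Function.update x j t) + δ := by
    refine nhdsWithin_le_nhds ((hp_cont j).continuousAt.eventually_lt
      (((hw_cont j).comp hupd).add continuous_const).continuousAt ?_)
    simp only [Function.update_eq_self]
    linarith
  obtain ⟨t, ht, hxt⟩ := (hev.and self_mem_nhdsWithin).exists
  have hxle : x ≤ Function.update x j t := le_update_self_iff.2 hxt.le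
  have hmem : Function.update x j t ∈ S := by
    refine ⟨hxS.1.trans hxle, fun i => ?_⟩
    rcases eq_or_ne i j with rfl | hij
    · simpa using ht.le
    · rw [Function.update_of_ne hij]
      linarith [hxS.2 i, hw_mono i j hij x t hxt.le]
  refine (hmax hmem).not_gt (Finset.sum_lt_sum (fun i _ => hxle i) ⟨j, Finset.mem_univ j, ?_⟩)
  simpa using hxt

/-- Theorem 2.1, conclusion: if the valid starting value `μ 0` satisfies `μ 0 j ≤ L j`
for all `j`, then the iterates of Algorithm 1 converge to the vector `L` of lower
confidence bounds, i.e. `μ^∞ = L`. -/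
theorem stmt13 (m : ℕ) (hm : 1 ≤ m)
    (q α : ℝ) (hq : q ∈ Set.Ioo (0 : ℝ) 1) (hα : α ∈ Set.Ioo (0 : ℝ) 1)
    (p : Fin m → ℝ → ℝ)
    (hp_cont : ∀ j, Continuous (p j))
    (hp_mono : ∀ j, StrictMono (p j))
    (hp_range : ∀ j t, p j t ∈ Set.Ioo (0 : ℝ) 1)
    (hp_bot : ∀ j, Tendsto (p j) atBot (nhds 0))
    (hp_top : ∀ j, Tendsto (p j) atTop (nhds 1))
    (ν : Fin m → (Fin m → ℝ) → ℝ)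
    (hν_cont : ∀ j, Continuous (ν j))
    (hν_mono : ∀ j, Monotone (ν j))
    (hν_pos : ∀ j μ, 0 < ν j μ)
    (hw_sum : ∀ μ : Fin m → ℝ, ∑ j, q ^ max (μ j) 0 * ν j μ = 1)
    (L : Fin m → ℝ)
    (hL : ∀ j, IsGLB ((fun μ => μ j) '' {μ : Fin m → ℝ | α < padj q p ν μ}) (L j))
    (μ : ℕ → Fin m → ℝ)
    (hstart : ∀ j, p j (μ 0 j) * q ^ (-(max (μ 0 j) 0)) ≤ ν j (μ 0) * α)
    (hstep : ∀ k j, p j (μ (k + 1) j) * q ^ (-(max (μ (k + 1) j) 0)) = ν j (μ k) * α)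
    (h0 : ∀ j, μ 0 j ≤ L j)
    (μinf : Fin m → ℝ)
    (hlim : ∀ j, Tendsto (fun k => μ k j) atTop (nhds (μinf j))) :
    μinf = L := by
  obtain ⟨hq0, hq1⟩ := hq
  have hqpos : ∀ t : ℝ, 0 < q ^ t := fun t => Real.rpow_pos_of_pos hq0 t
  have hw_pos : ∀ j x, 0 < q ^ max (x j) 0 * ν j x := fun j x => mul_pos (hqpos _) (hν_pos j x)
  have hmem : ∀ x, α < padj q p ν x ↔ ∀ j, α * (q ^ max (x j) 0 * ν j x) < p j (x j) :=
    fun x => lt_padj_iff hm fun j => hw_pos j x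
  have hq_cont : Continuous fun t : ℝ => q ^ t := Real.continuous_const_rpow hq0.ne'
  have hdiv : ∀ (t s y : ℝ), s * q ^ (-t) = y * α ↔ s = α * (q ^ t * y) := by
    intro t s y
    rw [Real.rpow_neg hq0.le, ← div_eq_mul_inv, div_eq_iff (hqpos t).ne']
    ring_nf
  have hμL : ∀ k j, μ k j ≤ L j := by
    intro k
    induction k with
    | zero => exact h0
    | succ k ih =>
      intro j
      refine (hL j).2 ?_
      rintro _ ⟨x, hx, rfl⟩
      have hkx : μ k ≤ x := fun i => (ih i).trans ((hL i).1 ⟨x, hx, rfl⟩)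
      have hxj := (hmem x).1 hx j
      have hk := (hdiv _ _ _).1 (hstep k j)
      by_contra! hlt
      have h1 : q ^ max (μ (k + 1) j) 0 ≤ q ^ max (x j) 0 :=
        Real.rpow_le_rpow_of_exponent_ge hq0 hq1.le (max_le_max_right 0 hlt.le)
      have h2 : q ^ max (μ (k + 1) j) 0 * ν j (μ k) ≤ q ^ max (x j) 0 * ν j x :=
        mul_le_mul h1 (hν_mono j hkx) (hν_pos _ _).le (hqpos _).le
      have h3 := mul_le_mul_of_nonneg_left h2 hα.1.le
      have h4 := hp_mono j hlt
      linarith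
  have hfix : ∀ j, p j (μinf j) = α * (q ^ max (μinf j) 0 * ν j μinf) := by
    intro j
    have hlim' : Tendsto μ atTop (𝓝 μinf) := tendsto_pi_nhds.2 hlim
    have hs : Tendsto (fun k => μ (k + 1) j) atTop (𝓝 (μinf j)) :=
      (hlim j).comp (tendsto_add_atTop_nat 1)
    have h1 := ((hp_cont j).tendsto _).comp hs
    have hqm : Continuous fun t : ℝ => q ^ max t 0 :=
      hq_cont.comp (continuous_id.max continuous_const)
    have h2 := (((hqm.tendsto _).comp hs).mul
      (((hν_cont j).tendsto _).comp hlim')).const_mul α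
    exact tendsto_nhds_unique h1 (h2.congr fun k => ((hdiv _ _ _).1 (hstep k j)).symm)
  funext j
  refine le_antisymm (le_of_tendsto' (hlim j) fun k => hμL k j) ?_
  refine le_of_forall_pos_le_add fun ε hε => ?_
  obtain ⟨x, hxε, hx⟩ := exists_lt_of_eq (c := α) hp_cont hp_mono
    (w := fun j x => α * (q ^ max (x j) 0 * ν j x))
    (fun j => continuous_const.mul ((hq_cont.comp
      ((continuous_apply j).max continuous_const)).mul (hν_cont j)))
    (fun x => by rw [← Finset.mul_sum, hw_sum, mul_one])
    (fun i j hij x t hxt => by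
      rw [Function.update_of_ne hij]
      exact mul_le_mul_of_nonneg_left (mul_le_mul_of_nonneg_left
        (hν_mono i (le_update_self_iff.2 hxt)) (hqpos _).le) hα.1.le)
    hfix hε
  exact ((hL j).1 ⟨x, (hmem x).2 hx, rfl⟩).trans (hxε j)
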